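/- arXiv:1504.08176 — 2 statements merged into one kernel-verified Lean document; each statement's English description precedes it below -/
import Mathlib

section
/- If μ : M → X is a CM-envelope of the finitely generated R-module M (so X is maximal Cohen–Macaulay), then the dual map μ† : X† → M† is a CM-cover of M†. -/
open CategoryTheory

noncomputable section

/-- `Ext^n_A(M, N)` as a module. -/
def ext1 (A : Type) [CommRing A] (n : ℕ) (M N : Type) [AddCommGroup M] [Module A M]
    [AddCommGroup N] [Module A N] : ModuleCat A :=
  ((Ext A (ModuleCat A) n).obj (Opposite.op (ModuleCat.of A M))).obj (ModuleCat.of A N)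

/-- The depth of a module over a local ring: the least `n` with `Ext^n(k, M) ≠ 0`
(`⊤` if no such `n`, e.g. for the zero module). -/
def rdepth (A : Type) [CommRing A] [IsLocalRing A] (M : Type) [AddCommGroup M] [Module A M] :
    ℕ∞ :=
  sInf {n : ℕ∞ | ∃ m : ℕ, n = m ∧ ¬ Subsingleton (ext1 A m (IsLocalRing.ResidueField A) M)}

/-- The dimension of a module, `dim M = dim (A / ann M)`. -/
def mdim (A : Type) [CommRing A] (M : Type) [AddCommGroup M] [Module A M] : WithBot ℕ∞ :=
  ringKrullDim (A ⧸ Module.annihilator A M)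

/-- `cod M > n`, i.e. `dim A - dim M > n`, i.e. `dim M + n < d`. -/
def codGT (A : Type) [CommRing A] (d : ℕ) (M : Type) [AddCommGroup M] [Module A M]
    (n : ℕ) : Prop :=
  mdim A M + n < (d : WithBot ℕ∞)

/-- `cod M ≥ n`, i.e. `dim M + n ≤ d`. -/
def codGE (A : Type) [CommRing A] (d : ℕ) (M : Type) [AddCommGroup M] [Module A M]
    (n : ℕ) : Prop :=
  mdim A M + n ≤ (d : WithBot ℕ∞)

/-- Maximal Cohen-Macaulay module over a `d`-dimensional local ring
(the zero module counts as MCM). -/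
def IsMCM (A : Type) [CommRing A] [IsLocalRing A] (d : ℕ) (M : Type) [AddCommGroup M]
    [Module A M] : Prop :=
  Module.Finite A M ∧ (d : ℕ∞) ≤ rdepth A M

/-- Serre's condition `(S_n)`: `depth M_p ≥ min {n, ht p}` for all primes `p`. -/
def SerreS (A : Type) [CommRing A] (n : ℕ) (M : Type) [AddCommGroup M] [Module A M] : Prop :=
  ∀ p : PrimeSpectrum A,
    min (n : WithBot ℕ∞) (ringKrullDim (Localization.AtPrime p.asIdeal))
      ≤ (rdepth (Localization.AtPrime p.asIdeal)
          (LocalizedModule p.asIdeal.primeCompl M) : ℕ∞)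

/-- Finite injective dimension: `Ext^m(-, M)` vanishes for all large `m`. -/
def HasFID (A : Type) [CommRing A] (M : Type) [AddCommGroup M] [Module A M] : Prop :=
  ∃ n : ℕ, ∀ (N : Type) [AddCommGroup N] [Module A N], ∀ m : ℕ, n < m →
    Subsingleton (ext1 A m N M)

/-- `ω` is a canonical module of the `d`-dimensional local ring `A`:
it is maximal Cohen-Macaulay, of finite injective dimension, and of type one. -/
def IsCanonicalModule (A : Type) [CommRing A] [IsLocalRing A] (d : ℕ) (ω : Type)
    [AddCommGroup ω] [Module A ω] : Prop :=
  IsMCM A d ω ∧ HasFID A ω ∧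
    Nonempty ((ext1 A d (IsLocalRing.ResidueField A) ω) ≃ₗ[A] IsLocalRing.ResidueField A)

/-- `μ : M → X` is a CM-preenvelope. -/
def IsCMPreenvelope (A : Type) [CommRing A] [IsLocalRing A] (d : ℕ) {M X : Type}
    [AddCommGroup M] [Module A M] [AddCommGroup X] [Module A X] (μ : M →ₗ[A] X) : Prop :=
  IsMCM A d X ∧ ∀ (Z : Type) [AddCommGroup Z] [Module A Z], IsMCM A d Z →
    ∀ f : M →ₗ[A] Z, ∃ g : X →ₗ[A] Z, g ∘ₗ μ = f

/-- `μ : M → X` is a special CM-preenvelope: a CM-preenvelope with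
`Ext^1(coker μ, Z) = 0` for all maximal Cohen-Macaulay `Z`. -/
def IsSpecialCMPreenvelope (A : Type) [CommRing A] [IsLocalRing A] (d : ℕ) {M X : Type}
    [AddCommGroup M] [Module A M] [AddCommGroup X] [Module A X] (μ : M →ₗ[A] X) : Prop :=
  IsCMPreenvelope A d μ ∧ ∀ (Z : Type) [AddCommGroup Z] [Module A Z], IsMCM A d Z →
    Subsingleton (ext1 A 1 (X ⧸ LinearMap.range μ) Z)

/-- `μ : M → X` is a CM-envelope. -/
def IsCMEnvelope (A : Type) [CommRing A] [IsLocalRing A] (d : ℕ) {M X : Type}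
    [AddCommGroup M] [Module A M] [AddCommGroup X] [Module A X] (μ : M →ₗ[A] X) : Prop :=
  IsCMPreenvelope A d μ ∧ ∀ φ : X →ₗ[A] X, φ ∘ₗ μ = μ → Function.Bijective φ

/-- `π : X → M` is a CM-precover. -/
def IsCMPrecover (A : Type) [CommRing A] [IsLocalRing A] (d : ℕ) {X M : Type}
    [AddCommGroup X] [Module A X] [AddCommGroup M] [Module A M] (π : X →ₗ[A] M) : Prop :=
  IsMCM A d X ∧ ∀ (Z : Type) [AddCommGroup Z] [Module A Z], IsMCM A d Z →
    ∀ f : Z →ₗ[A] M, ∃ g : Z →ₗ[A] X, π ∘ₗ g = f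

/-- `π : X → M` is a special CM-precover: a CM-precover with
`Ext^1(Z, ker π) = 0` for all maximal Cohen-Macaulay `Z`. -/
def IsSpecialCMPrecover (A : Type) [CommRing A] [IsLocalRing A] (d : ℕ) {X M : Type}
    [AddCommGroup X] [Module A X] [AddCommGroup M] [Module A M] (π : X →ₗ[A] M) : Prop :=
  IsCMPrecover A d π ∧ ∀ (Z : Type) [AddCommGroup Z] [Module A Z], IsMCM A d Z →
    Subsingleton (ext1 A 1 Z ↥(LinearMap.ker π))

/-- `π : X → M` is a CM-cover. -/
def IsCMCover (A : Type) [CommRing A] [IsLocalRing A] (d : ℕ) {X M : Type}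
    [AddCommGroup X] [Module A X] [AddCommGroup M] [Module A M] (π : X →ₗ[A] M) : Prop :=
  IsCMPrecover A d π ∧ ∀ φ : X →ₗ[A] X, π ∘ₗ φ = π → Function.Bijective φ

/-- `M` has no nonzero free direct summand. -/
def NoNonzeroFreeSummand (A : Type) [CommRing A] (M : Type) [AddCommGroup M]
    [Module A M] : Prop :=
  ∀ F G : Submodule A M, IsCompl F G → Module.Free A ↥F → F = ⊥

/-- `W` belongs to `add ω`: it is a direct summand of a finite direct sum of copies of `ω`. -/
def InAdd (A : Type) [CommRing A] (ω : Type) [AddCommGroup ω] [Module A ω] (W : Type)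
    [AddCommGroup W] [Module A W] : Prop :=
  ∃ (n : ℕ) (W' : ModuleCat.{0} A), Nonempty ((W × ↥W') ≃ₗ[A] (Fin n → ω))

section delta

variable (A : Type) [CommRing A] (ω : Type) [AddCommGroup ω] [Module A ω]

/-- The natural evaluation map `δ_M : M → M†† = Hom(Hom(M, ω), ω)`. -/
def deltaMap (M : Type) [AddCommGroup M] [Module A M] :
    M →ₗ[A] ((M →ₗ[A] ω) →ₗ[A] ω) :=
  (LinearMap.id : (M →ₗ[A] ω) →ₗ[A] (M →ₗ[A] ω)).flip

/-- The dual `f† = Hom(f, ω)` of a linear map `f`. -/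
def dmap {M N : Type} [AddCommGroup M] [Module A M] [AddCommGroup N] [Module A N]
    (f : M →ₗ[A] N) : (N →ₗ[A] ω) →ₗ[A] (M →ₗ[A] ω) :=
  LinearMap.lcomp A ω f

end delta

/-- The homology `ker g / im f` at the middle spot of `M → N → P`. -/
abbrev homMod (A : Type) [CommRing A] {M N P : Type} [AddCommGroup M] [Module A M]
    [AddCommGroup N] [Module A N] [AddCommGroup P] [Module A P]
    (f : M →ₗ[A] N) (g : N →ₗ[A] P) : Type :=
  ↥(LinearMap.ker g) ⧸ Submodule.comap (LinearMap.ker g).subtype (LinearMap.range f)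

end

noncomputable section

section comparison

open CategoryTheory Limits

variable {R : Type} [CommRing R] {X Y : ModuleCat.{0} R} (P : ProjectiveResolution X)

lemma smul_extMk (r : R) {n : ℕ} (f : P.complex.X n ⟶ Y) (m : ℕ) (hm : n + 1 = m)
    (hf : P.complex.d m n ≫ f = 0) :
    r • P.extMk f m hm hf = P.extMk (r • f) m hm (by simp [hf]) := by
  rw [Abelian.Ext.smul_eq_comp_mk₀, ProjectiveResolution.extMk_comp_mk₀]
  simp

lemma extMk_zero_eq_zero_iff (f : P.complex.X 0 ⟶ Y) (hf : P.complex.d 1 0 ≫ f = 0) :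
    P.extMk f 1 rfl hf = 0 ↔ f = 0 := by
  refine ⟨fun h ↦ ?_, fun h ↦ by subst h; simp⟩
  simp only [← P.extEquivCohomologyClass.apply_eq_iff_eq,
    ProjectiveResolution.extEquivCohomologyClass_extMk,
    ProjectiveResolution.extEquivCohomologyClass_zero,
    CochainComplex.HomComplex.CohomologyClass.mk_eq_zero_iff] at h
  rw [CochainComplex.HomComplex.Cocycle.toSingleMk_mem_coboundaries_iff _ _ _ _ _ 1 (by simp)] at h
  obtain ⟨g, hg⟩ := h
  have hz : IsZero (P.cochainComplex.X 1) := P.cochainComplex.isZero_of_isStrictlyLE 0 1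
  rw [hz.eq_of_src g 0] at hg
  rw [comp_zero] at hg
  rw [← cancel_epi (P.cochainComplexXIso (-((0 : ℕ) : ℤ)) 0 rfl).hom, ← hg, comp_zero]

/-- The cocycles of `Hom(P, Y)` map onto `Ext X Y n`. -/
def cocyclesToExt (n : ℕ) :
    LinearMap.ker (((P.complex.linearYonedaObj R Y).sc n).g.hom) →ₗ[R] Abelian.Ext.{0} X Y n where
  toFun z := P.extMk z.1 ((ComplexShape.up ℕ).next n) (by simp) z.2
  map_add' a b := (P.add_extMk _ _ _ _ a.2 b.2).symm
  map_smul' r a := (smul_extMk P r _ _ _ a.2).symm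

lemma cocyclesToExt_surjective (n : ℕ) :
    Function.Surjective (cocyclesToExt (Y := Y) P n) := by
  intro α
  obtain ⟨f, hf, rfl⟩ := P.extMk_surjective α ((ComplexShape.up ℕ).next n) (by simp)
  exact ⟨⟨f, hf⟩, rfl⟩

lemma extMk_eq_zero_of_eq {n m m' : ℕ} (f : P.complex.X n ⟶ Y) (hm : n + 1 = m)
    (hm' : n + 1 = m') (hf : P.complex.d m n ≫ f = 0) (hf' : P.complex.d m' n ≫ f = 0) :
    P.extMk f m hm hf = 0 ↔ P.extMk f m' hm' hf' = 0 := by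
  subst hm hm'
  rfl

lemma ker_cocyclesToExt (n : ℕ) :
    LinearMap.ker (cocyclesToExt (Y := Y) P n) =
      LinearMap.range ((P.complex.linearYonedaObj R Y).sc n).moduleCatToCycles := by
  ext z
  obtain ⟨z, hz⟩ := z
  have key : cocyclesToExt P n ⟨z, hz⟩ = 0 ↔
      ∃ y, ((P.complex.linearYonedaObj R Y).sc n).f.hom y = z := by
    cases n with
    | zero =>
      let z' : P.complex.X 0 ⟶ Y := z
      have hn : (ComplexShape.up ℕ).next 0 = 1 := by simp
      have hz' : P.complex.d 1 0 ≫ z' = 0 := by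
        rw [← hn]
        exact hz
      refine (extMk_eq_zero_of_eq P z' (by simp) rfl hz hz').trans
        ((extMk_zero_eq_zero_iff P z' hz').trans ?_)
      have h0 : ((P.complex.linearYonedaObj R Y).sc 0).f = 0 :=
        (P.complex.linearYonedaObj R Y).shape _ _ (by simp)
      rw [h0]
      exact ⟨fun h ↦ ⟨0, h.symm⟩, fun ⟨_, h⟩ ↦ h.symm⟩
    | succ p =>
      refine (P.extMk_eq_zero_iff z _ (by simp) hz ((ComplexShape.up ℕ).prev (p + 1))
        (by simp)).trans ?_
      rfl
  rw [LinearMap.mem_ker, key]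
  exact ⟨fun ⟨y, hy⟩ ↦ ⟨y, Subtype.ext hy⟩, fun ⟨y, hy⟩ ↦ ⟨y, congrArg Subtype.val hy⟩⟩

end comparison

/-- The derived-functor `Ext` agrees with the `Ext` of the derived category. -/
def ext1Equiv (R : Type) [CommRing R] (n : ℕ) (M N : Type) [AddCommGroup M] [Module R M]
    [AddCommGroup N] [Module R N] :
    ext1 R n M N ≃ₗ[R] Abelian.Ext.{0} (ModuleCat.of R M) (ModuleCat.of R N) n :=
  let P := projectiveResolution (ModuleCat.of R M)
  ((P.isoExt n (ModuleCat.of R N)).toLinearEquiv.trans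
    ((P.complex.linearYonedaObj R (ModuleCat.of R N)).sc n).moduleCatHomologyIso.toLinearEquiv).trans
    ((Submodule.quotEquivOfEq _ _ (ker_cocyclesToExt P n).symm).trans
      ((cocyclesToExt P n).quotKerEquivOfSurjective (cocyclesToExt_surjective P n)))

/-- `Ext^n_R(M, N)`, computed in the derived category. -/
abbrev ExtMod (R : Type) [CommRing R] (M N : Type) [AddCommGroup M] [Module R M]
    [AddCommGroup N] [Module R N] (n : ℕ) : Type :=
  Abelian.Ext.{0} (ModuleCat.of R M) (ModuleCat.of R N) n

namespace ExtMod

section general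

variable {R : Type} [CommRing R] {A B C : Type} [AddCommGroup A] [Module R A]
  [AddCommGroup B] [Module R B] [AddCommGroup C] [Module R C]
  {M Y : Type} [AddCommGroup M] [Module R M] [AddCommGroup Y] [Module R Y]

/-- `Ext^0` is `Hom`. -/
def zeroEquiv : ExtMod R M Y 0 ≃ₗ[R] (M →ₗ[R] Y) :=
  Abelian.Ext.linearEquiv₀.trans ModuleCat.homLinearEquiv

/-- Contravariant functoriality of `Ext`. -/
def pre (f : A →ₗ[R] B) (Y : Type) [AddCommGroup Y] [Module R Y] (n : ℕ) :
    ExtMod R B Y n →ₗ[R] ExtMod R A Y n :=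
  (Abelian.Ext.mk₀ (ModuleCat.ofHom f)).precompOfLinear R (ModuleCat.of R Y) (zero_add n)

/-- Covariant functoriality of `Ext`. -/
def post (f : A →ₗ[R] B) (M : Type) [AddCommGroup M] [Module R M] (n : ℕ) :
    ExtMod R M A n →ₗ[R] ExtMod R M B n :=
  (Abelian.Ext.mk₀ (ModuleCat.ofHom f)).postcompOfLinear R (ModuleCat.of R M) (add_zero n)

lemma zeroEquiv_pre (f : A →ₗ[R] B) (z : ExtMod R B Y 0) :
    zeroEquiv (pre f Y 0 z) = zeroEquiv z ∘ₗ f := by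
  obtain ⟨g, rfl⟩ := (zeroEquiv (R := R) (M := B) (Y := Y)).symm.surjective z
  rw [LinearEquiv.apply_symm_apply, ← LinearEquiv.eq_symm_apply]
  exact Abelian.Ext.mk₀_comp_mk₀ (ModuleCat.ofHom f) (ModuleCat.ofHom g)

lemma zeroEquiv_post (f : A →ₗ[R] B) (z : ExtMod R M A 0) :
    zeroEquiv (post f M 0 z) = f ∘ₗ zeroEquiv z := by
  obtain ⟨g, rfl⟩ := (zeroEquiv (R := R) (M := M) (Y := A)).symm.surjective z
  rw [LinearEquiv.apply_symm_apply, ← LinearEquiv.eq_symm_apply]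
  exact Abelian.Ext.mk₀_comp_mk₀ (ModuleCat.ofHom g) (ModuleCat.ofHom f)

lemma pre_comp (f : A →ₗ[R] B) (g : B →ₗ[R] C) (n : ℕ) (z : ExtMod R C Y n) :
    pre (g ∘ₗ f) Y n z = pre f Y n (pre g Y n z) :=
  (Abelian.Ext.mk₀_comp_mk₀_assoc (ModuleCat.ofHom f) (ModuleCat.ofHom g) z).symm

lemma pre_smul (r : R) (f : A →ₗ[R] B) (n : ℕ) (z : ExtMod R B Y n) :
    pre (r • f) Y n z = r • pre f Y n z := by
  have : ModuleCat.ofHom (r • f) = r • ModuleCat.ofHom f := rfl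
  simp only [pre, this, Abelian.Ext.mk₀_smul, map_smul, LinearMap.smul_apply]

lemma pre_add (f g : A →ₗ[R] B) (n : ℕ) (z : ExtMod R B Y n) :
    pre (f + g) Y n z = pre f Y n z + pre g Y n z := by
  have : ModuleCat.ofHom (f + g) = ModuleCat.ofHom f + ModuleCat.ofHom g := rfl
  simp only [pre, this, Abelian.Ext.mk₀_add, map_add, LinearMap.add_apply]

lemma pre_zero (n : ℕ) (z : ExtMod R B Y n) : pre (0 : A →ₗ[R] B) Y n z = 0 := by
  simpa using pre_smul (0 : R) (0 : A →ₗ[R] B) n z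

lemma pre_sum {ι : Type} (s : Finset ι) (f : ι → A →ₗ[R] B) (n : ℕ) (z : ExtMod R B Y n) :
    pre (∑ i ∈ s, f i) Y n z = ∑ i ∈ s, pre (f i) Y n z := by
  classical
  induction s using Finset.induction_on with
  | empty => simp [pre_zero]
  | insert i s hi ih => rw [Finset.sum_insert hi, Finset.sum_insert hi, pre_add, ih]

lemma pre_id (n : ℕ) (z : ExtMod R A Y n) : pre LinearMap.id Y n z = z :=
  Abelian.Ext.mk₀_id_comp (X := ModuleCat.of R A) z

lemma pre_smul_id (r : R) (n : ℕ) (z : ExtMod R A Y n) :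
    pre (r • LinearMap.id) Y n z = r • z := by
  rw [pre_smul, pre_id]

lemma post_smul_id (r : R) (n : ℕ) (z : ExtMod R M A n) :
    post (r • LinearMap.id) M n z = r • z :=
  (Abelian.Ext.smul_eq_comp_mk₀ z r).symm

lemma smul_eq_zero_left {r : R} (h : ∀ a : A, r • a = 0) (n : ℕ) (z : ExtMod R A Y n) :
    r • z = 0 := by
  have h0 : r • (LinearMap.id : A →ₗ[R] A) = 0 := LinearMap.ext h
  rw [← pre_smul_id, h0, pre_zero]

lemma subsingleton_left [Subsingleton A] (n : ℕ) : Subsingleton (ExtMod R A Y n) :=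
  subsingleton_of_forall_eq 0 fun z ↦ by
    rw [← one_smul R z]
    exact smul_eq_zero_left (fun a ↦ Subsingleton.elim _ _) n z

lemma subsingleton_right [Subsingleton Y] (n : ℕ) : Subsingleton (ExtMod R M Y n) :=
  subsingleton_of_forall_eq 0 fun z ↦ by
    have h0 : ((1 : R) • LinearMap.id : Y →ₗ[R] Y) = (0 : R) • LinearMap.id :=
      LinearMap.ext fun a ↦ Subsingleton.elim _ _
    rw [← one_smul R z, ← post_smul_id, h0, post_smul_id, zero_smul]

lemma subsingleton_of_projective [Module.Projective R A] (n : ℕ) :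
    Subsingleton (ExtMod R A Y (n + 1)) :=
  have : Projective (ModuleCat.of R A) := (IsProjective.iff_projective A).mp inferInstance
  subsingleton_of_forall_eq 0 fun z ↦ Abelian.Ext.eq_zero_of_projective z

lemma shortExact {f : A →ₗ[R] B} {g : B →ₗ[R] C} (hf : Function.Injective f)
    (hg : Function.Surjective g) (h : Function.Exact f g) :
    (ModuleCat.shortComplexOfCompEqZero f g h.linearMap_comp_eq_zero).ShortExact where
  exact := ModuleCat.shortComplex_exact _ h
  mono_f := (ModuleCat.mono_iff_injective _).mpr hf
  epi_g := (ModuleCat.epi_iff_surjective _).mpr hg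

section LES

variable {f : A →ₗ[R] B} {g : B →ₗ[R] C} (hf : Function.Injective f)
    (hg : Function.Surjective g) (h : Function.Exact f g)

/-- The connecting map of the contravariant long exact sequence. -/
def preδ (Y : Type) [AddCommGroup Y] [Module R Y] (n : ℕ) :
    ExtMod R A Y n →ₗ[R] ExtMod R C Y (n + 1) :=
  (shortExact hf hg h).extClass.precompOfLinear R (ModuleCat.of R Y) (add_comm 1 n)

/-- The connecting map of the covariant long exact sequence. -/
def postδ (M : Type) [AddCommGroup M] [Module R M] (n : ℕ) :
    ExtMod R M C n →ₗ[R] ExtMod R M A (n + 1) :=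
  (shortExact hf hg h).extClass.postcompOfLinear R (ModuleCat.of R M) rfl

include hf hg h in
lemma exists_pre_eq {n : ℕ} (z : ExtMod R B Y n) (hz : pre f Y n z = 0) :
    ∃ w, pre g Y n w = z :=
  Abelian.Ext.contravariant_sequence_exact₂ (shortExact hf hg h) (ModuleCat.of R Y) z hz

lemma exists_pre_eq_of_preδ {n : ℕ} (z : ExtMod R A Y n) (hz : preδ hf hg h Y n z = 0) :
    ∃ w, pre f Y n w = z :=
  Abelian.Ext.contravariant_sequence_exact₁ (shortExact hf hg h) (ModuleCat.of R Y) z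
    (add_comm 1 n) hz

lemma exists_preδ_eq {n : ℕ} (z : ExtMod R C Y (n + 1)) (hz : pre g Y (n + 1) z = 0) :
    ∃ w, preδ hf hg h Y n w = z :=
  Abelian.Ext.contravariant_sequence_exact₃ (shortExact hf hg h) (ModuleCat.of R Y) z hz
    (add_comm 1 n)

include hf hg h in
lemma exists_post_eq {n : ℕ} (z : ExtMod R M B n) (hz : post g M n z = 0) :
    ∃ w, post f M n w = z :=
  Abelian.Ext.covariant_sequence_exact₂ (ModuleCat.of R M) (shortExact hf hg h) z hz

lemma exists_post_eq_of_postδ {n : ℕ} (z : ExtMod R M C n) (hz : postδ hf hg h M n z = 0) :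
    ∃ w, post g M n w = z :=
  Abelian.Ext.covariant_sequence_exact₃ (ModuleCat.of R M) (shortExact hf hg h) z rfl hz

lemma exists_postδ_eq {n : ℕ} (z : ExtMod R M A (n + 1)) (hz : post f M (n + 1) z = 0) :
    ∃ w, postδ hf hg h M n w = z :=
  Abelian.Ext.covariant_sequence_exact₁ (ModuleCat.of R M) (shortExact hf hg h) z hz rfl

include hf hg h

lemma subsingleton_pre_mid {n : ℕ} (hA : Subsingleton (ExtMod R A Y n))
    (hC : Subsingleton (ExtMod R C Y n)) : Subsingleton (ExtMod R B Y n) :=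
  subsingleton_of_forall_eq 0 fun z ↦ by
    obtain ⟨w, rfl⟩ := exists_pre_eq hf hg h z (Subsingleton.elim _ _)
    rw [Subsingleton.elim w 0, map_zero]

lemma subsingleton_pre_left {n : ℕ} (hB : Subsingleton (ExtMod R B Y n))
    (hC : Subsingleton (ExtMod R C Y (n + 1))) : Subsingleton (ExtMod R A Y n) :=
  subsingleton_of_forall_eq 0 fun z ↦ by
    obtain ⟨w, rfl⟩ := exists_pre_eq_of_preδ hf hg h z (Subsingleton.elim _ _)
    rw [Subsingleton.elim w 0, map_zero]

lemma subsingleton_post_mid {n : ℕ} (hA : Subsingleton (ExtMod R M A n))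
    (hC : Subsingleton (ExtMod R M C n)) : Subsingleton (ExtMod R M B n) :=
  subsingleton_of_forall_eq 0 fun z ↦ by
    obtain ⟨w, rfl⟩ := exists_post_eq hf hg h z (Subsingleton.elim _ _)
    rw [Subsingleton.elim w 0, map_zero]

lemma subsingleton_post_left {n : ℕ} (hC : Subsingleton (ExtMod R M C n))
    (hB : Subsingleton (ExtMod R M B (n + 1))) : Subsingleton (ExtMod R M A (n + 1)) :=
  subsingleton_of_forall_eq 0 fun z ↦ by
    obtain ⟨w, rfl⟩ := exists_postδ_eq hf hg h z (Subsingleton.elim _ _)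
    rw [Subsingleton.elim w 0, map_zero]

/-- If `Ext^1(C, Y) = 0` then maps `A → Y` extend along `A → B`. -/
lemma exists_extension (hC : Subsingleton (ExtMod R C Y 1)) (φ : A →ₗ[R] Y) :
    ∃ ψ : B →ₗ[R] Y, ψ ∘ₗ f = φ := by
  obtain ⟨w, hw⟩ := exists_pre_eq_of_preδ hf hg h (zeroEquiv.symm φ) (Subsingleton.elim _ _)
  refine ⟨zeroEquiv w, ?_⟩
  rw [← zeroEquiv_pre, hw, LinearEquiv.apply_symm_apply]

end LES

lemma subsingleton_post_zero {f : A →ₗ[R] B} (hf : Function.Injective f)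
    (hB : Subsingleton (ExtMod R M B 0)) : Subsingleton (ExtMod R M A 0) :=
  subsingleton_of_forall_eq 0 fun z ↦ by
    have h0 : f ∘ₗ zeroEquiv z = 0 := by
      rw [← zeroEquiv_post, Subsingleton.elim (post f M 0 z) 0, map_zero]
    apply zeroEquiv.injective
    rw [map_zero]
    exact LinearMap.ext fun x ↦ hf (by simpa using LinearMap.congr_fun h0 x)

lemma subsingleton_congr_left (e : A ≃ₗ[R] B) {n : ℕ} (hB : Subsingleton (ExtMod R B Y n)) :
    Subsingleton (ExtMod R A Y n) :=
  subsingleton_of_forall_eq 0 fun z ↦ by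
    rw [← pre_id n z, ← e.symm_comp, pre_comp, Subsingleton.elim (pre _ Y n z) 0, map_zero]

end general

section finite

variable {R : Type} [CommRing R] [IsNoetherianRing R]

instance finite_linearMap (M N : Type) [AddCommGroup M] [Module R M] [AddCommGroup N]
    [Module R N] [Module.Finite R M] [Module.Finite R N] : Module.Finite R (M →ₗ[R] N) := by
  obtain ⟨n, f, hf⟩ := Module.Finite.exists_fin' R M
  refine Module.Finite.of_injective (LinearMap.lcomp R N f) fun a b hab ↦ ?_
  exact LinearMap.ext fun x ↦ by
    obtain ⟨y, rfl⟩ := hf x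
    exact LinearMap.congr_fun hab y

instance finite (M N : Type) [AddCommGroup M] [Module R M] [AddCommGroup N]
    [Module R N] [Module.Finite R M] [Module.Finite R N] (n : ℕ) :
    Module.Finite R (ExtMod R M N n) := by
  induction n generalizing M with
  | zero => exact Module.Finite.equiv zeroEquiv.symm
  | succ n ih =>
    obtain ⟨m, f, hf⟩ := Module.Finite.exists_fin' R M
    have hs := subsingleton_of_projective (R := R) (A := Fin m → R) (Y := N) n
    exact Module.Finite.of_surjective
      (preδ (LinearMap.ker f).injective_subtype hf (LinearMap.exact_subtype_ker_map f) N n)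
      fun z ↦ exists_preδ_eq _ _ _ z (Subsingleton.elim _ _)

end finite

end ExtMod

/-- `Ext^i(k, N) = 0` for all `i < t`, where `k` is the residue field. -/
def DepthGE (R : Type) [CommRing R] [IsLocalRing R] (N : Type) [AddCommGroup N] [Module R N]
    (t : ℕ) : Prop :=
  ∀ i < t, Subsingleton (ExtMod R (IsLocalRing.ResidueField R) N i)

lemma le_rdepth_iff {R : Type} [CommRing R] [IsLocalRing R] {N : Type} [AddCommGroup N]
    [Module R N] {t : ℕ} : (t : ℕ∞) ≤ rdepth R N ↔ DepthGE R N t := by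
  rw [rdepth, le_sInf_iff]
  constructor
  · intro h i hi
    by_contra hs
    refine absurd (h i ⟨i, rfl, fun hs' ↦ hs ?_⟩) (by simpa using hi)
    exact (ext1Equiv R i _ N).symm.injective.subsingleton
  · rintro h _ ⟨i, rfl, hs⟩
    by_contra hi
    have := h i (by simpa using hi)
    exact hs (ext1Equiv R i _ N).injective.subsingleton

section regular

open scoped Pointwise

variable {R : Type} [CommRing R] {N Y : Type} [AddCommGroup N] [Module R N]
  [AddCommGroup Y] [Module R Y] {x : R}

lemma exact_smul_id_mkQ (x : R) (N : Type) [AddCommGroup N] [Module R N] :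
    Function.Exact (x • LinearMap.id : N →ₗ[R] N)
      (Submodule.mkQ (x • ⊤ : Submodule R N)) :=
  LinearMap.exact_lsmul_mkQ_smul_top N x

lemma smul_id_injective (hx : IsSMulRegular N x) :
    Function.Injective (x • LinearMap.id : N →ₗ[R] N) := fun _ _ h ↦ hx h

/-- The connecting map `Ext^n(N, Y) → Ext^{n+1}(N/xN, Y)`. -/
def quotδ (hx : IsSMulRegular N x) (Y : Type) [AddCommGroup Y] [Module R Y] (n : ℕ) :
    ExtMod R N Y n →ₗ[R] ExtMod R (QuotSMulTop x N) Y (n + 1) :=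
  ExtMod.preδ (f := (x • LinearMap.id : N →ₗ[R] N)) (g := Submodule.mkQ (x • ⊤ : Submodule R N))
    (smul_id_injective hx) (Submodule.mkQ_surjective _) (exact_smul_id_mkQ x N) Y n

lemma exists_smul_of_quotδ_eq_zero (hx : IsSMulRegular N x) {n : ℕ} (z : ExtMod R N Y n)
    (hz : quotδ hx Y n z = 0) : ∃ w, z = x • w := by
  obtain ⟨w, hw⟩ := ExtMod.exists_pre_eq_of_preδ _ _ _ z hz
  exact ⟨w, by rw [← hw, ExtMod.pre_smul_id]⟩

lemma quotδ_surjective (hx : IsSMulRegular N x) {n : ℕ}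
    (h : Subsingleton (ExtMod R N Y (n + 1))) : Function.Surjective (quotδ hx Y n) :=
  fun z ↦ ExtMod.exists_preδ_eq _ _ _ z (Subsingleton.elim _ _)

lemma subsingleton_quotSMulTop (hx : IsSMulRegular N x) {n : ℕ}
    (h : Subsingleton (ExtMod R N Y n)) (h' : Subsingleton (ExtMod R N Y (n + 1))) :
    Subsingleton (ExtMod R (QuotSMulTop x N) Y (n + 1)) :=
  (quotδ_surjective hx h').subsingleton

variable [IsLocalRing R]

lemma subsingleton_of_forall_exists_smul {P : Type} [AddCommGroup P] [Module R P]
    [Module.Finite R P] (hx : x ∈ IsLocalRing.maximalIdeal R) (h : ∀ z : P, ∃ w, z = x • w) :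
    Subsingleton P := by
  rw [← Submodule.subsingleton_iff R, ← subsingleton_iff_bot_eq_top]
  refine (Submodule.eq_bot_of_le_smul_of_le_jacobson_bot (IsLocalRing.maximalIdeal R) ⊤
    Module.Finite.fg_top (fun z _ ↦ ?_) (IsLocalRing.maximalIdeal_le_jacobson ⊥)).symm
  obtain ⟨w, rfl⟩ := h z
  exact Submodule.smul_mem_smul hx trivial

lemma smul_residueField (hx : x ∈ IsLocalRing.maximalIdeal R)
    (a : IsLocalRing.ResidueField R) : x • a = 0 := by
  rw [Algebra.smul_def, IsLocalRing.ResidueField.algebraMap_eq,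
    (IsLocalRing.residue_eq_zero_iff x).mpr hx, zero_mul]

lemma mem_of_mem_annihilator_residueField
    (hx : x ∈ Module.annihilator R (IsLocalRing.ResidueField R)) :
    x ∈ IsLocalRing.maximalIdeal R := by
  have h1 := Module.mem_annihilator.mp hx 1
  rw [Algebra.smul_def, mul_one, IsLocalRing.ResidueField.algebraMap_eq] at h1
  exact (IsLocalRing.residue_eq_zero_iff x).mp h1

/-- `Ext^t(k, N/xN) ≃ Ext^{t+1}(k, N)` for `x ∈ m` regular on `N` with `Ext^t(k, N) = 0`. -/
def extQuotEquiv (hx : IsSMulRegular N x) (hxm : x ∈ IsLocalRing.maximalIdeal R) {t : ℕ}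
    (h : Subsingleton (ExtMod R (IsLocalRing.ResidueField R) N t)) :
    ExtMod R (IsLocalRing.ResidueField R) (QuotSMulTop x N) t ≃ₗ[R]
      ExtMod R (IsLocalRing.ResidueField R) N (t + 1) :=
  LinearEquiv.ofBijective
    (ExtMod.postδ (f := (x • LinearMap.id : N →ₗ[R] N))
      (g := Submodule.mkQ (x • ⊤ : Submodule R N))
      (smul_id_injective hx) (Submodule.mkQ_surjective _) (exact_smul_id_mkQ x N) _ t) <| by
    constructor
    · rw [injective_iff_map_eq_zero]
      intro z hz
      obtain ⟨w, rfl⟩ := ExtMod.exists_post_eq_of_postδ _ _ _ z hz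
      rw [Subsingleton.elim w 0, map_zero]
    · intro z
      refine ExtMod.exists_postδ_eq _ _ _ z ?_
      rw [ExtMod.post_smul_id]
      exact ExtMod.smul_eq_zero_left (smul_residueField hxm) _ z

lemma DepthGE.quotSMulTop {t : ℕ} (h : DepthGE R N (t + 1)) (hx : IsSMulRegular N x)
    (hxm : x ∈ IsLocalRing.maximalIdeal R) : DepthGE R (QuotSMulTop x N) t := fun i hi ↦
  have := h (i + 1) (by lia)
  (extQuotEquiv hx hxm (h i (by lia))).injective.subsingleton

lemma DepthGE.mono {s t : ℕ} (h : DepthGE R N t) (hst : s ≤ t) : DepthGE R N s :=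
  fun i hi ↦ h i (hi.trans_le hst)

lemma DepthGE.of_equiv {t : ℕ} (h : DepthGE R N t) (e : Y ≃ₗ[R] N) : DepthGE R Y t := by
  intro i hi
  have := h i hi
  refine subsingleton_of_forall_eq 0 fun z ↦ ?_
  have hc := ExtMod.subsingleton_post_mid (f := (0 : (Fin 0 → R) →ₗ[R] Y))
    (g := e.toLinearMap) (n := i) (M := IsLocalRing.ResidueField R)
    (fun a b _ ↦ Subsingleton.elim a b) e.surjective (fun y ↦ by simp [eq_comm (a := (0 : Y))])
    (ExtMod.subsingleton_right i) this
  exact Subsingleton.elim z 0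

variable [IsNoetherianRing R]

lemma subsingleton_of_subsingleton_quotSMulTop [Module.Finite R N] [Module.Finite R Y]
    (hx : IsSMulRegular N x) (hxm : x ∈ IsLocalRing.maximalIdeal R) {n : ℕ}
    (h : Subsingleton (ExtMod R (QuotSMulTop x N) Y (n + 1))) :
    Subsingleton (ExtMod R N Y n) :=
  subsingleton_of_forall_exists_smul hxm fun z ↦
    exists_smul_of_quotδ_eq_zero hx z (Subsingleton.elim _ _)

lemma exists_regular [Module.Finite R N]
    (h : Subsingleton (ExtMod R (IsLocalRing.ResidueField R) N 0)) :
    ∃ x ∈ IsLocalRing.maximalIdeal R, IsSMulRegular N x := by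
  have h' : Subsingleton (IsLocalRing.ResidueField R →ₗ[R] N) :=
    ExtMod.zeroEquiv.symm.injective.subsingleton
  obtain ⟨x, hx, hr⟩ := IsSMulRegular.subsingleton_linearMap_iff.mp h'
  exact ⟨x, mem_of_mem_annihilator_residueField hx, hr⟩

lemma DepthGE.exists_regular [Module.Finite R N] {t : ℕ} (h : DepthGE R N (t + 1)) :
    ∃ x ∈ IsLocalRing.maximalIdeal R, IsSMulRegular N x :=
  _root_.exists_regular (h 0 (by lia))

lemma DepthGE.le_supportDim {N : Type} [AddCommGroup N] [Module R N] [Module.Finite R N]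
    [Nontrivial N] {t : ℕ} (h : DepthGE R N t) : (t : WithBot ℕ∞) ≤ Module.supportDim R N := by
  induction t generalizing N with
  | zero =>
    obtain ⟨a, ha⟩ := WithBot.ne_bot_iff_exists.mp (Module.supportDim_ne_bot_of_nontrivial R N)
    rw [← ha]
    exact_mod_cast bot_le (a := a)
  | succ t ih =>
    obtain ⟨x, hxm, hx⟩ := h.exists_regular
    have : Nontrivial (QuotSMulTop x N) := by
      by_contra hn
      rw [not_nontrivial_iff_subsingleton] at hn
      refine not_subsingleton N (subsingleton_of_forall_exists_smul hxm fun z ↦ ?_)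
      have hz : z ∈ (x • ⊤ : Submodule R N) :=
        (Submodule.Quotient.mk_eq_zero _).mp
          (Subsingleton.elim (α := QuotSMulTop x N) (Submodule.Quotient.mk z) 0)
      obtain ⟨w, -, hw⟩ := (Submodule.mem_smul_pointwise_iff_exists _ _ _).mp hz
      exact ⟨w, hw.symm⟩
    rw [← Module.supportDim_quotSMulTop_succ_eq_supportDim hx hxm]
    push_cast
    exact add_le_add_left (ih (h.quotSMulTop hx hxm)) 1

/-- A nonzero finite module has depth at most the dimension of the ring. -/
lemma DepthGE.not_subsingleton {d t : ℕ} (hd : ringKrullDim R = d) [Module.Finite R N]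
    [Nontrivial N] (h : DepthGE R N t) (htd : d ≤ t) :
    ¬ Subsingleton (ExtMod R (IsLocalRing.ResidueField R) N d) := fun hs ↦ by
  have h' : DepthGE R N (d + 1) := fun i hi ↦ by
    obtain hi | rfl := (Nat.lt_succ_iff_lt_or_eq.mp hi)
    exacts [h i (hi.trans_le htd), hs]
  have h2 := h'.le_supportDim.trans (Module.supportDim_le_ringKrullDim R N)
  rw [hd] at h2
  have : d + 1 ≤ d := by exact_mod_cast h2
  lia

lemma exists_finite_hom_residueField_ne_zero {ω : Type} [AddCommGroup ω] [Module R ω] (t : ℕ)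
    {N : Type} [AddCommGroup N] [Module R N] [Module.Finite R N] {s : ℕ} (h : DepthGE R N t)
    (hN : ¬ Subsingleton (ExtMod R (IsLocalRing.ResidueField R) N t))
    (hv : ∀ i > s, Subsingleton (ExtMod R N ω i)) :
    ∃ N₀ : ModuleCat.{0} R, Module.Finite R N₀ ∧
      ¬ Subsingleton (ExtMod R (IsLocalRing.ResidueField R) N₀ 0) ∧
      ∀ i > s + t, Subsingleton (ExtMod R N₀ ω i) := by
  induction t generalizing N s with
  | zero => exact ⟨ModuleCat.of R N, inferInstance, hN, hv⟩
  | succ t ih =>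
    obtain ⟨x, hxm, hx⟩ := h.exists_regular
    have e := extQuotEquiv hx hxm (h t (by lia))
    obtain ⟨N₀, h1, h2, h3⟩ := ih (s := s + 1) (h.quotSMulTop hx hxm)
      (fun hs ↦ hN e.symm.injective.subsingleton) (fun i hi ↦ by
        obtain ⟨j, rfl⟩ : ∃ j, i = j + 1 := ⟨i - 1, by lia⟩
        exact subsingleton_quotSMulTop hx (hv j (by lia)) (hv (j + 1) (by lia)))
    exact ⟨N₀, h1, h2, fun i hi ↦ h3 i (by lia)⟩

omit [IsNoetherianRing R] in
lemma exists_injective_residueField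
    (h : ¬ Subsingleton (ExtMod R (IsLocalRing.ResidueField R) N 0)) :
    ∃ f : IsLocalRing.ResidueField R →ₗ[R] N, Function.Injective f := by
  rw [not_subsingleton_iff_nontrivial] at h
  obtain ⟨z, hz⟩ := exists_ne (0 : ExtMod R (IsLocalRing.ResidueField R) N 0)
  refine ⟨ExtMod.zeroEquiv z, (injective_iff_map_eq_zero _).mpr fun a ha ↦ ?_⟩
  by_contra ha0
  apply hz
  apply ExtMod.zeroEquiv.injective
  rw [map_zero]
  ext b
  obtain ⟨r, hr⟩ := IsLocalRing.residue_surjective (b * a⁻¹)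
  have : b = r • a := by
    rw [Algebra.smul_def, IsLocalRing.ResidueField.algebraMap_eq, hr,
      inv_mul_cancel_right₀ ha0]
  rw [this, map_smul, ha, smul_zero, LinearMap.zero_apply]

/-- If `Ext^i(-, ω)` vanishes on finite modules for large `i` and `R` is Cohen–Macaulay of
dimension `d`, it vanishes for all `i > d`. -/
lemma subsingleton_ext_of_dim_lt {d : ℕ} (hd : ringKrullDim R = d) (hR : DepthGE R R d)
    {ω : Type} [AddCommGroup ω] [Module R ω] [Module.Finite R ω]
    (hfid : ∃ n : ℕ, ∀ (N : Type) [AddCommGroup N] [Module R N], ∀ m : ℕ, n < m →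
      Subsingleton (ExtMod R N ω m))
    (N : Type) [AddCommGroup N] [Module R N] [Module.Finite R N] {i : ℕ} (hi : d < i) :
    Subsingleton (ExtMod R N ω i) := by
  obtain ⟨n, hn⟩ := hfid
  obtain ⟨N₀, hN₀, hk, hv⟩ := exists_finite_hom_residueField_ne_zero (ω := ω) (s := 0) d hR
    (hR.not_subsingleton hd le_rfl) (fun i hi ↦ by
      obtain ⟨j, rfl⟩ : ∃ j, i = j + 1 := ⟨i - 1, by lia⟩
      exact ExtMod.subsingleton_of_projective j)
  obtain ⟨ι, hι⟩ := exists_injective_residueField hk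
  have key : ∀ j : ℕ, (∀ (N : Type) [AddCommGroup N] [Module R N] [Module.Finite R N],
      ∀ i > d + j, Subsingleton (ExtMod R N ω i)) →
      ∀ (N : Type) [AddCommGroup N] [Module R N] [Module.Finite R N],
      ∀ i > d, Subsingleton (ExtMod R N ω i) := by
    intro j
    induction j with
    | zero => exact fun h ↦ h
    | succ j ih =>
      refine fun h ↦ ih fun N _ _ _ i hi ↦ ?_
      obtain hi' | rfl : i > d + (j + 1) ∨ i = d + j + 1 := by lia
      · exact h N i hi'
      have hres : Subsingleton (ExtMod R (IsLocalRing.ResidueField R) ω (d + j + 1)) :=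
        ExtMod.subsingleton_pre_left hι (LinearMap.range ι).mkQ_surjective
          (LinearMap.exact_map_mkQ_range ι) (hv _ (by lia)) (h _ _ (by lia))
      refine IsNoetherianRing.induction_on_isQuotientEquivQuotientPrime R
        (motive := fun N _ _ _ ↦ Subsingleton (ExtMod R N ω (d + j + 1))) inferInstance ?_ ?_ ?_
      · intro N _ _ _ _
        exact ExtMod.subsingleton_left _
      · intro N _ _ _ p e
        refine ExtMod.subsingleton_congr_left e ?_
        by_cases hp : p.asIdeal = IsLocalRing.maximalIdeal R
        · rw [hp]
          exact hres
        · obtain ⟨x, hxm, hxp⟩ := SetLike.exists_of_lt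
            (lt_of_le_of_ne (IsLocalRing.le_maximalIdeal p.isPrime.ne_top) hp)
          refine subsingleton_of_subsingleton_quotSMulTop (x := x) ?_ hxm (h _ _ (by lia))
          rw [isSMulRegular_iff_right_eq_zero_of_smul]
          intro a ha
          obtain ⟨b, rfl⟩ := Ideal.Quotient.mk_surjective a
          rw [Algebra.smul_def, Ideal.Quotient.algebraMap_eq, ← map_mul,
            Ideal.Quotient.eq_zero_iff_mem] at ha
          exact Ideal.Quotient.eq_zero_iff_mem.mpr ((p.isPrime.mem_or_mem ha).resolve_left hxp)
      · intro N₁ _ _ _ N₂ _ _ _ N₃ _ _ _ f g hf hg hfg h1 h3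
        exact ExtMod.subsingleton_pre_mid hf hg hfg h1 h3
  exact key n (fun N _ _ _ i hi ↦ hn N i (by lia)) N i hi

lemma DepthGE.subsingleton_ext {d : ℕ} {ω : Type} [AddCommGroup ω] [Module R ω]
    [Module.Finite R ω]
    (hω : ∀ (N : Type) [AddCommGroup N] [Module R N] [Module.Finite R N], ∀ i > d,
      Subsingleton (ExtMod R N ω i))
    {N : Type} [AddCommGroup N] [Module R N] [Module.Finite R N] {t i : ℕ} (h : DepthGE R N t)
    (hit : d < i + t) : Subsingleton (ExtMod R N ω i) := by
  induction t generalizing N i with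
  | zero => exact hω N i hit
  | succ t ih =>
    obtain ⟨x, hxm, hx⟩ := h.exists_regular
    exact subsingleton_of_subsingleton_quotSMulTop hx hxm
      (ih (h.quotSMulTop hx hxm) (by lia))

end regular

section depth

variable {R : Type} [CommRing R] [IsLocalRing R] {A B C : Type} [AddCommGroup A] [Module R A]
  [AddCommGroup B] [Module R B] [AddCommGroup C] [Module R C]
  {f : A →ₗ[R] B} {g : B →ₗ[R] C}

lemma DepthGE.left_succ (hf : Function.Injective f) (hg : Function.Surjective g)
    (h : Function.Exact f g) {s : ℕ} (hB : DepthGE R B (s + 1)) (hC : DepthGE R C s) :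
    DepthGE R A (s + 1)
  | 0, _ => ExtMod.subsingleton_post_zero hf (hB 0 (by lia))
  | i + 1, hi => ExtMod.subsingleton_post_left hf hg h (hC i (by lia)) (hB (i + 1) hi)

lemma DepthGE.left (hf : Function.Injective f) (hg : Function.Surjective g)
    (h : Function.Exact f g) {t : ℕ} (hB : DepthGE R B t) (hC : DepthGE R C t) :
    DepthGE R A t := by
  cases t with
  | zero => exact fun i hi ↦ absurd hi (by lia)
  | succ s => exact hB.left_succ hf hg h (hC.mono (by lia))

lemma DepthGE.mid (hf : Function.Injective f) (hg : Function.Surjective g)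
    (h : Function.Exact f g) {t : ℕ} (hA : DepthGE R A t) (hC : DepthGE R C t) :
    DepthGE R B t :=
  fun i hi ↦ ExtMod.subsingleton_post_mid hf hg h (hA i hi) (hC i hi)

lemma DepthGE.pi {t : ℕ} (hA : DepthGE R A t) (n : ℕ) : DepthGE R (Fin n → A) t := by
  induction n with
  | zero => exact fun i _ ↦ ExtMod.subsingleton_right i
  | succ n ih =>
    exact (DepthGE.mid LinearMap.inl_injective LinearMap.snd_surjective
      Function.Exact.inl_snd hA ih).of_equiv (Fin.consLinearEquiv R fun _ ↦ A).symm

end depth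

section dual

variable {R : Type} [CommRing R] {A B C : Type} [AddCommGroup A] [Module R A]
  [AddCommGroup B] [Module R B] [AddCommGroup C] [Module R C]
  {f : A →ₗ[R] B} {g : B →ₗ[R] C}

lemma dmap_injective (Y : Type) [AddCommGroup Y] [Module R Y] (hg : Function.Surjective g) :
    Function.Injective (dmap R Y g) := fun a b hab ↦ LinearMap.ext fun x ↦ by
  obtain ⟨y, rfl⟩ := hg x
  exact LinearMap.congr_fun hab y

lemma dmap_exact (Y : Type) [AddCommGroup Y] [Module R Y] (hf : Function.Injective f)
    (hg : Function.Surjective g) (h : Function.Exact f g) :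
    Function.Exact (dmap R Y g) (dmap R Y f) := fun φ ↦ by
  constructor
  · intro hφ
    obtain ⟨w, hw⟩ := ExtMod.exists_pre_eq hf hg h (ExtMod.zeroEquiv.symm φ) <| by
      apply ExtMod.zeroEquiv.injective
      rw [ExtMod.zeroEquiv_pre, LinearEquiv.apply_symm_apply, map_zero]
      exact hφ
    refine ⟨ExtMod.zeroEquiv w, ?_⟩
    change ExtMod.zeroEquiv w ∘ₗ g = φ
    rw [← ExtMod.zeroEquiv_pre, hw, LinearEquiv.apply_symm_apply]
  · rintro ⟨ψ, rfl⟩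
    change (ψ ∘ₗ g) ∘ₗ f = 0
    rw [LinearMap.comp_assoc, h.linearMap_comp_eq_zero, LinearMap.comp_zero]

end dual

/-- `R` is Cohen–Macaulay of dimension `d` and `ω` is a canonical module, in terms of
vanishing of `ExtMod`. -/
structure CanonicalData (R : Type) [CommRing R] [IsLocalRing R] (d : ℕ) (ω : Type)
    [AddCommGroup ω] [Module R ω] : Prop where
  dim : ringKrullDim R = d
  depth_self : DepthGE R R d
  finite : Module.Finite R ω
  depth : DepthGE R ω d
  vanish : ∀ (N : Type) [AddCommGroup N] [Module R N] [Module.Finite R N], ∀ i > d,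
    Subsingleton (ExtMod R N ω i)
  type_one : Nonempty (ExtMod R (IsLocalRing.ResidueField R) ω d ≃ₗ[R]
    IsLocalRing.ResidueField R)

lemma IsCanonicalModule.canonicalData {R : Type} [CommRing R] [IsNoetherianRing R]
    [IsLocalRing R] {d : ℕ} (hdim : ringKrullDim R = d) (hCM : (d : ℕ∞) ≤ rdepth R R)
    {ω : Type} [AddCommGroup ω] [Module R ω] (hω : IsCanonicalModule R d ω) :
    CanonicalData R d ω := by
  obtain ⟨⟨hfin, hdep⟩, ⟨n, hn⟩, ⟨e⟩⟩ := hω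
  refine ⟨hdim, le_rdepth_iff.mp hCM, hfin, le_rdepth_iff.mp hdep, fun N _ _ _ i hi ↦ ?_,
    ⟨(ext1Equiv R d _ ω).symm.trans e⟩⟩
  refine subsingleton_ext_of_dim_lt hdim (le_rdepth_iff.mp hCM) ⟨n, fun N _ _ m hm ↦ ?_⟩ N hi
  have := hn N m hm
  exact (ext1Equiv R m N ω).symm.injective.subsingleton

section nakayama

variable {R : Type} [CommRing R] [IsLocalRing R]

lemma forall_eq_smul_of_sub_mem {P : Type} [AddCommGroup P] [Module R P] [Module.Finite R P]
    (e : P) (h : ∀ y : P, ∃ r : R, y - r • e ∈ IsLocalRing.maximalIdeal R • (⊤ : Submodule R P)) :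
    ∀ y : P, ∃ r : R, y = r • e := by
  have key : (⊤ : Submodule R P) ≤ Submodule.span R {e} :=
    Submodule.le_of_le_smul_of_le_jacobson_bot Module.Finite.fg_top
      (IsLocalRing.maximalIdeal_le_jacobson ⊥) fun y _ ↦ by
        obtain ⟨r, hr⟩ := h y
        rw [← add_sub_cancel (r • e) y]
        exact Submodule.add_mem_sup (Submodule.smul_mem _ _ (Submodule.mem_span_singleton_self e)) hr
  intro y
  obtain ⟨r, hr⟩ := Submodule.mem_span_singleton.mp (key (Submodule.mem_top (x := y)))
  exact ⟨r, hr.symm⟩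

end nakayama

namespace CanonicalData

variable {R : Type} [CommRing R] [IsNoetherianRing R] [IsLocalRing R] {d : ℕ} {ω : Type}
  [AddCommGroup ω] [Module R ω] (D : CanonicalData R d ω)

include D

omit [IsNoetherianRing R] in
lemma pre_surjective {A B : Type} [AddCommGroup A] [Module R A] [AddCommGroup B] [Module R B]
    [Module.Finite R B] {f : A →ₗ[R] B} (hf : Function.Injective f) :
    Function.Surjective (ExtMod.pre f ω d) := fun z ↦
  have := D.vanish (B ⧸ LinearMap.range f) (d + 1) (by lia)
  ExtMod.exists_pre_eq_of_preδ hf (LinearMap.range f).mkQ_surjective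
    (LinearMap.exact_map_mkQ_range f) z (Subsingleton.elim _ _)

lemma mem_smul_top_of_pre_eq_zero {N : Type} [AddCommGroup N] [Module R N] [Module.Finite R N]
    {A : Type} [AddCommGroup A] [Module R A] {ι : A →ₗ[R] N} (hι : Function.Injective ι)
    (hr : ∀ y : N, (∀ x ∈ IsLocalRing.maximalIdeal R, x • y = 0) → ∃ a, ι a = y)
    (hA : ∀ a : A, ∀ x ∈ IsLocalRing.maximalIdeal R, x • a = 0)
    (z : ExtMod R N ω d) (hz : ExtMod.pre ι ω d z = 0) :
    z ∈ IsLocalRing.maximalIdeal R • (⊤ : Submodule R (ExtMod R N ω d)) := by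
  classical
  obtain ⟨n, s, hs⟩ := Submodule.fg_iff_exists_fin_generating_family.mp
    (IsLocalRing.maximalIdeal R).fg_of_isNoetherianRing
  have hsm : ∀ i, s i ∈ IsLocalRing.maximalIdeal R := fun i ↦ by
    rw [← hs]
    exact Submodule.subset_span ⟨i, rfl⟩
  let α : N →ₗ[R] (Fin n → N) :=
    ∑ i, s i • LinearMap.single R (fun _ ↦ N) i
  have hα : ∀ y i, α y i = s i • y := fun y i ↦ by
    simp [α, LinearMap.sum_apply, Finset.sum_apply, Pi.single_apply]
  have hex : Function.Exact ι α.rangeRestrict := fun y ↦ by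
    rw [← LinearMap.mem_ker, LinearMap.ker_rangeRestrict, LinearMap.mem_ker]
    constructor
    · intro hy
      refine hr y fun x hx ↦ ?_
      rw [← hs] at hx
      refine Submodule.span_induction (p := fun x _ ↦ x • y = 0) ?_ (zero_smul R y)
        (fun a b _ _ ha hb ↦ by rw [add_smul, ha, hb, add_zero])
        (fun a b _ hb ↦ by rw [smul_assoc, hb, smul_zero]) hx
      rintro _ ⟨i, rfl⟩
      rw [← hα, hy, Pi.zero_apply]
    · rintro ⟨a, rfl⟩
      ext i
      rw [hα, ← map_smul, hA a _ (hsm i), map_zero, Pi.zero_apply]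
  obtain ⟨w, rfl⟩ := ExtMod.exists_pre_eq hι α.surjective_rangeRestrict hex z hz
  obtain ⟨v, rfl⟩ := D.pre_surjective (LinearMap.range α).injective_subtype w
  rw [← ExtMod.pre_comp, LinearMap.subtype_comp_codRestrict, ExtMod.pre_sum]
  refine Submodule.sum_mem _ fun i _ ↦ ?_
  rw [ExtMod.pre_smul]
  exact Submodule.smul_mem_smul (hsm i) trivial

lemma exists_generator {s t : ℕ} (hst : s + t = d) {N : Type} [AddCommGroup N] [Module R N]
    [Module.Finite R N] (h : DepthGE R N t)
    (e : ExtMod R (IsLocalRing.ResidueField R) N t ≃ₗ[R] IsLocalRing.ResidueField R) :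
    ∃ e : ExtMod R N ω s, ∀ y, ∃ r : R, y = r • e := by
  have := D.finite
  induction t generalizing N s with
  | zero =>
    obtain rfl : s = d := hst
    obtain ⟨ε⟩ := D.type_one
    let e' := e.symm.trans ExtMod.zeroEquiv
    let ι := e' 1
    have hcyc : ∀ φ : IsLocalRing.ResidueField R →ₗ[R] N, ∃ r : R, φ = r • ι := fun φ ↦ by
      obtain ⟨r, hr⟩ := IsLocalRing.residue_surjective (e'.symm φ)
      refine ⟨r, ?_⟩
      rw [← map_smul, Algebra.smul_def, mul_one, IsLocalRing.ResidueField.algebraMap_eq, hr,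
        LinearEquiv.apply_symm_apply]
    obtain ⟨ι', hι'⟩ := exists_injective_residueField (R := R) (N := N) fun hs ↦
      one_ne_zero (α := IsLocalRing.ResidueField R) (e.symm.injective (Subsingleton.elim _ _))
    have hι : Function.Injective ι := by
      obtain ⟨r, rfl⟩ := hcyc ι'
      intro a b hab
      exact hι' (by simp [hab])
    have hr : ∀ y : N, (∀ x ∈ IsLocalRing.maximalIdeal R, x • y = 0) → ∃ a, ι a = y := by
      intro y hy
      let φ : IsLocalRing.ResidueField R →ₗ[R] N :=
        Submodule.liftQ (IsLocalRing.maximalIdeal R) (LinearMap.toSpanSingleton R N y) hy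
      have hφ : φ (IsLocalRing.residue R 1) = y :=
        (Submodule.liftQ_apply _ _ _).trans (by simp)
      obtain ⟨r, h⟩ := hcyc φ
      refine ⟨r • 1, ?_⟩
      rw [map_smul, ← LinearMap.smul_apply, ← h, ← map_one (IsLocalRing.residue R), hφ]
    obtain ⟨g, hg⟩ := D.pre_surjective hι (ε.symm 1)
    refine ⟨g, forall_eq_smul_of_sub_mem g fun y ↦ ?_⟩
    obtain ⟨r, hr'⟩ := IsLocalRing.residue_surjective (ε (ExtMod.pre ι ω s y))
    refine ⟨r, D.mem_smul_top_of_pre_eq_zero hι hr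
      (fun a x hx ↦ smul_residueField hx a) _ ?_⟩
    apply ε.injective
    rw [map_sub, map_smul, hg, map_sub, map_smul, LinearEquiv.apply_symm_apply, ← hr',
      Algebra.smul_def, mul_one, IsLocalRing.ResidueField.algebraMap_eq, sub_self, map_zero]
  | succ t ih =>
    obtain ⟨x, hxm, hx⟩ := h.exists_regular
    obtain ⟨g', hg'⟩ := ih (s := s + 1) (by lia) (h.quotSMulTop hx hxm)
      ((extQuotEquiv hx hxm (h t (by lia))).trans e)
    obtain ⟨g, rfl⟩ := quotδ_surjective hx
      (DepthGE.subsingleton_ext D.vanish h (i := s + 1) (by lia)) g'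
    refine ⟨g, forall_eq_smul_of_sub_mem g fun y ↦ ?_⟩
    obtain ⟨r, hr⟩ := hg' (quotδ hx ω s y)
    obtain ⟨w, hw⟩ := exists_smul_of_quotδ_eq_zero hx (y - r • g) (by
      rw [map_sub, map_smul, hr, sub_self])
    refine ⟨r, ?_⟩
    rw [hw]
    exact Submodule.smul_mem_smul hxm trivial

lemma not_subsingleton_ext {s t : ℕ} (hst : s + t = d) {N : Type} [AddCommGroup N] [Module R N]
    [Module.Finite R N] (h : DepthGE R N t)
    (hN : ¬ Subsingleton (ExtMod R (IsLocalRing.ResidueField R) N t)) :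
    ¬ Subsingleton (ExtMod R N ω s) := by
  have := D.finite
  induction t generalizing N s with
  | zero =>
    obtain rfl : s = d := hst
    obtain ⟨ε⟩ := D.type_one
    obtain ⟨ι, hι⟩ := exists_injective_residueField hN
    intro hs
    have := (D.pre_surjective hι).subsingleton
    exact one_ne_zero (α := IsLocalRing.ResidueField R)
      (ε.symm.injective (Subsingleton.elim _ _))
  | succ t ih =>
    obtain ⟨x, hxm, hx⟩ := h.exists_regular
    intro hs
    refine ih (s := s + 1) (by lia) (h.quotSMulTop hx hxm) (fun hs' ↦ hN ?_) ?_
    · exact (extQuotEquiv hx hxm (h t (by lia))).symm.injective.subsingleton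
    · exact (quotδ_surjective hx
        (DepthGE.subsingleton_ext D.vanish h (i := s + 1) (by lia))).subsingleton

lemma subsingleton_of_dual {N : Type} [AddCommGroup N] [Module R N] [Module.Finite R N]
    (h : DepthGE R N d) (hs : Subsingleton (N →ₗ[R] ω)) : Subsingleton N := by
  by_contra hN
  rw [not_subsingleton_iff_nontrivial] at hN
  exact D.not_subsingleton_ext (zero_add d) h (h.not_subsingleton D.dim le_rfl)
    ExtMod.zeroEquiv.injective.subsingleton

lemma exists_extension {A B C : Type} [AddCommGroup A] [Module R A]
    [AddCommGroup B] [Module R B] [AddCommGroup C] [Module R C] [Module.Finite R C]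
    {f : A →ₗ[R] B} {g : B →ₗ[R] C} (hf : Function.Injective f) (hg : Function.Surjective g)
    (h : Function.Exact f g) (hC : DepthGE R C d) :
    Function.Surjective (dmap R ω f) := fun φ ↦
  have := D.finite
  ExtMod.exists_extension hf hg h (DepthGE.subsingleton_ext D.vanish hC (by lia)) φ

lemma depthGE_dual {X : Type} [AddCommGroup X] [Module R X] [Module.Finite R X]
    (h : DepthGE R X d) : DepthGE R (X →ₗ[R] ω) d := by
  suffices H : ∀ s ≤ d, DepthGE R (X →ₗ[R] ω) s from H d le_rfl
  intro s
  induction s generalizing X with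
  | zero => exact fun _ i hi ↦ absurd hi (by lia)
  | succ s ih =>
    intro hs
    obtain ⟨n, g, hg⟩ := Module.Finite.exists_fin' R X
    have hf := (LinearMap.ker g).injective_subtype
    have hfg := LinearMap.exact_subtype_ker_map g
    have hK := (D.depth_self.pi n).left hf hg hfg h
    refine DepthGE.left_succ (dmap_injective ω hg) (D.exists_extension hf hg hfg h)
      (dmap_exact ω hf hg hfg) ?_ (ih hK (by lia))
    exact ((D.depth.pi n).mono hs).of_equiv
      ((LinearMap.lsum R (fun _ : Fin n ↦ R) R).symm.trans
        (LinearEquiv.piCongrRight fun _ ↦ LinearMap.ringLmapEquivSelf R R ω))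

lemma exists_smul_id (f : ω →ₗ[R] ω) : ∃ r : R, ∀ w, f w = r • w := by
  have := D.finite
  obtain ⟨ε⟩ := D.type_one
  obtain ⟨g, hg⟩ := D.exists_generator (zero_add d) D.depth ε
  have hg' : ∀ f : ω →ₗ[R] ω, ∃ r : R, ∀ w, f w = r • ExtMod.zeroEquiv g w := fun f ↦ by
    obtain ⟨r, hr⟩ := hg (ExtMod.zeroEquiv.symm f)
    refine ⟨r, fun w ↦ ?_⟩
    rw [← LinearMap.smul_apply, ← map_smul, ← hr, LinearEquiv.apply_symm_apply]
  obtain ⟨r, hr⟩ := hg' LinearMap.id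
  by_cases hu : IsUnit r
  · obtain ⟨u, rfl⟩ := hu
    obtain ⟨s, hs⟩ := hg' f
    refine ⟨s * ↑u⁻¹, fun w ↦ ?_⟩
    conv_rhs => rw [← LinearMap.id_apply (R := R) w, hr]
    rw [hs, smul_smul, mul_assoc, Units.inv_mul, mul_one]
  · have hω : Subsingleton ω := subsingleton_of_forall_exists_smul
      ((IsLocalRing.mem_maximalIdeal r).mpr hu) fun z ↦ ⟨_, hr z⟩
    have := ExtMod.subsingleton_right (R := R) (M := IsLocalRing.ResidueField R) (Y := ω) d
    exact absurd (ε.symm.injective (Subsingleton.elim (ε.symm 1) (ε.symm 0))) one_ne_zero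

lemma eq_zero_of_forall_smul {r : R} (hr : ∀ w : ω, r • w = 0) : r = 0 := by
  have := D.finite
  let g : R →ₗ[R] (ω →ₗ[R] ω) := LinearMap.lsmul R ω
  have hg : Function.Surjective g := fun f ↦ by
    obtain ⟨s, hs⟩ := D.exists_smul_id f
    exact ⟨s, LinearMap.ext fun w ↦ (hs w).symm⟩
  have hf := (LinearMap.ker g).injective_subtype
  have hfg := LinearMap.exact_subtype_ker_map g
  have hE := D.depthGE_dual D.depth
  have hI : Subsingleton (LinearMap.ker g) := by
    refine D.subsingleton_of_dual (D.depth_self.left hf hg hfg hE)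
      (subsingleton_of_forall_eq 0 fun φ ↦ ?_)
    obtain ⟨ψ, rfl⟩ := D.exists_extension hf hg hfg hE φ
    ext ⟨a, ha⟩
    change ψ a = 0
    rw [← mul_one a, ← smul_eq_mul, map_smul]
    exact LinearMap.congr_fun (LinearMap.mem_ker.mp ha) (ψ 1)
  exact congrArg Subtype.val
    (Subsingleton.elim (⟨r, LinearMap.mem_ker.mpr (LinearMap.ext hr)⟩ : LinearMap.ker g) 0)

lemma deltaMap_pi_injective (n : ℕ) :
    Function.Injective (deltaMap R ω (Fin n → R)) := by
  rw [injective_iff_map_eq_zero]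
  intro v hv
  ext i
  exact D.eq_zero_of_forall_smul fun w ↦
    LinearMap.congr_fun hv ((LinearMap.proj (φ := fun _ : Fin n ↦ R) i).smulRight w)

lemma deltaMap_pi_surjective (n : ℕ) :
    Function.Surjective (deltaMap R ω (Fin n → R)) := by
  classical
  intro Φ
  have key : ∀ i : Fin n, ∃ r : R, ∀ w : ω, Φ ((LinearMap.proj i).smulRight w) = r • w :=
    fun i ↦ D.exists_smul_id
      { toFun := fun w ↦ Φ ((LinearMap.proj i).smulRight w)
        map_add' := fun a b ↦ by
          rw [← map_add]; congr 1; ext; simp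
        map_smul' := fun r b ↦ by
          rw [RingHom.id_apply, ← map_smul]; congr 1; ext; simp [smul_comm _ r] }
  choose v hv using key
  refine ⟨v, LinearMap.ext fun φ ↦ ?_⟩
  change φ v = Φ φ
  have hφ : φ = ∑ i, (LinearMap.proj i).smulRight (φ (Pi.single i 1)) := by
    refine LinearMap.ext fun u ↦ ?_
    conv_lhs => rw [pi_eq_sum_univ' u]
    simp
  conv_rhs => rw [hφ]
  conv_lhs => rw [pi_eq_sum_univ' v]
  simp [hv]

lemma deltaMap_surjective {X : Type} [AddCommGroup X] [Module R X] [Module.Finite R X]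
    (h : DepthGE R X d) : Function.Surjective (deltaMap R ω X) := by
  have := D.finite
  obtain ⟨n, g, hg⟩ := Module.Finite.exists_fin' R X
  have hf := (LinearMap.ker g).injective_subtype
  have hfg := LinearMap.exact_subtype_ker_map g
  have hK := (D.depth_self.pi n).left hf hg hfg h
  intro Φ
  obtain ⟨Ψ, rfl⟩ := D.exists_extension (dmap_injective ω hg) (D.exists_extension hf hg hfg h)
    (dmap_exact ω hf hg hfg) (D.depthGE_dual hK) Φ
  obtain ⟨v, rfl⟩ := D.deltaMap_pi_surjective n Ψ
  exact ⟨g v, rfl⟩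

lemma deltaMap_injective {X : Type} [AddCommGroup X] [Module R X] [Module.Finite R X]
    (h : DepthGE R X d) : Function.Injective (deltaMap R ω X) := by
  obtain ⟨n, g, hg⟩ := Module.Finite.exists_fin' R X
  have hf := (LinearMap.ker g).injective_subtype
  have hfg := LinearMap.exact_subtype_ker_map g
  have hK := (D.depth_self.pi n).left hf hg hfg h
  rw [injective_iff_map_eq_zero]
  intro x hx
  obtain ⟨v, rfl⟩ := hg x
  obtain ⟨Φ, hΦ⟩ := (dmap_exact ω (dmap_injective ω hg) (D.exists_extension hf hg hfg h)
    (dmap_exact ω hf hg hfg) (deltaMap R ω _ v)).mp hx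
  obtain ⟨κ, rfl⟩ := D.deltaMap_surjective hK Φ
  have hv : (κ : Fin n → R) = v := D.deltaMap_pi_injective n hΦ
  rw [← hv]
  exact LinearMap.mem_ker.mp κ.2

end CanonicalData

lemma isMCM_iff {R : Type} [CommRing R] [IsLocalRing R] {d : ℕ} {X : Type} [AddCommGroup X]
    [Module R X] : IsMCM R d X ↔ Module.Finite R X ∧ DepthGE R X d :=
  and_congr_right fun _ ↦ le_rdepth_iff

section cover

variable {R : Type} [CommRing R] [IsNoetherianRing R] [IsLocalRing R] {d : ℕ} {ω : Type}
  [AddCommGroup ω] [Module R ω] {M X : Type} [AddCommGroup M] [Module R M] [AddCommGroup X]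
  [Module R X] {μ : M →ₗ[R] X}

lemma CanonicalData.isMCM_dual (D : CanonicalData R d ω) (h : IsMCM R d X) :
    IsMCM R d (X →ₗ[R] ω) := by
  have := D.finite
  have := h.1
  exact isMCM_iff.mpr ⟨inferInstance, D.depthGE_dual (isMCM_iff.mp h).2⟩

lemma CanonicalData.isCMPrecover_dmap (D : CanonicalData R d ω) (h : IsCMPreenvelope R d μ) :
    IsCMPrecover R d (dmap R ω μ) := by
  refine ⟨D.isMCM_dual h.1, fun Z _ _ hZ f ↦ ?_⟩
  obtain ⟨g, hg⟩ := h.2 _ (D.isMCM_dual hZ) f.flip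
  refine ⟨g.flip, LinearMap.ext fun z ↦ LinearMap.ext fun m ↦ ?_⟩
  exact LinearMap.congr_fun (LinearMap.congr_fun hg m) z

lemma CanonicalData.isCMCover_dmap (D : CanonicalData R d ω) (h : IsCMEnvelope R d μ) :
    IsCMCover R d (dmap R ω μ) := by
  refine ⟨D.isCMPrecover_dmap h.1, fun φ hφ ↦ ?_⟩
  obtain ⟨hfin, hdep⟩ := isMCM_iff.mp h.1.1
  let δ : X ≃ₗ[R] ((X →ₗ[R] ω) →ₗ[R] ω) := LinearEquiv.ofBijective (deltaMap R ω X)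
    ⟨D.deltaMap_injective hdep, D.deltaMap_surjective hdep⟩
  let ψ : X →ₗ[R] X := δ.symm.toLinearMap ∘ₗ dmap R ω φ ∘ₗ δ.toLinearMap
  have hψ : ∀ p x, p (ψ x) = φ p x := fun p x ↦
    LinearMap.congr_fun (δ.apply_symm_apply (dmap R ω φ (δ x))) p
  have hψμ : ψ ∘ₗ μ = μ := LinearMap.ext fun m ↦ δ.injective <| LinearMap.ext fun p ↦
    (hψ p (μ m)).trans (LinearMap.congr_fun (LinearMap.congr_fun hφ p) m)
  let e := LinearEquiv.ofBijective ψ (h.2 ψ hψμ)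
  have he : ∀ p x, φ p x = p (e x) := fun p x ↦ (hψ p x).symm
  constructor
  · intro p q hpq
    refine LinearMap.ext fun x ↦ ?_
    rw [← e.apply_symm_apply x, ← he, ← he, hpq]
  · intro q
    refine ⟨q ∘ₗ e.symm.toLinearMap, LinearMap.ext fun x ↦ ?_⟩
    rw [he]
    simp

end cover

end

/-- if `μ : M → X` is a CM-envelope, then `μ† : X† → M†` is a CM-cover. -/
theorem dual_of_cm_envelope (R : Type) [CommRing R] [IsNoetherianRing R] [IsLocalRing R]
    (d : ℕ) (hdim : ringKrullDim R = d) (hCM : (d : ℕ∞) ≤ rdepth R R)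
    (ω : Type) [AddCommGroup ω] [Module R ω] (hω : IsCanonicalModule R d ω)
    (M X : Type) [AddCommGroup M] [Module R M] [AddCommGroup X] [Module R X]
    [Module.Finite R M] (μ : M →ₗ[R] X) (h : IsCMEnvelope R d μ) :
    IsCMCover R d (dmap R ω μ) := by
  exact (hω.canonicalData hdim hCM).isCMCover_dmap h
end

section
/- Let C be a finitely generated R-module and suppose 0 → L →f C →g N → 0 and 0 → L' →f' C →g' N' → 0 are exact sequences of finitely generated R-modules with cod L > 0, cod L' > 0, and N, N' satisfying Serre's condition (S_1). Then the two sequences are isomorphic as complexes: there exist isomorphisms s : L' → L and t : N' → N with f s = f' and t g' = g. -/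
open CategoryTheory

/-- If the `Ext`-module defined by deriving in the first variable vanishes, then so does the
`Ext`-group defined as a group of morphisms in the derived category. -/
lemma subsingleton_abelianExt_of_ext1 {A : Type} [CommRing A] {n : ℕ} {M N : Type}
    [AddCommGroup M] [Module A M] [AddCommGroup N] [Module A N]
    (h : Subsingleton (ext1 A n M N)) :
    Subsingleton (Abelian.Ext (ModuleCat.of A M) (ModuleCat.of A N) n) := by
  let P := projectiveResolution (ModuleCat.of A M)
  let K := P.complex.linearYonedaObj A (ModuleCat.of A N)
  have hz : Limits.IsZero (K.homology n) :=
    (ModuleCat.isZero_of_subsingleton (ext1 A n M N)).of_iso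
      (P.isoExt (R := A) n (ModuleCat.of A N)).symm
  have hex : K.ExactAt n := (K.exactAt_iff_isZero_homology n).2 hz
  refine subsingleton_of_forall_eq 0 fun α ↦ ?_
  obtain ⟨φ, hφ, rfl⟩ := P.extMk_surjective α (n + 1) rfl
  cases n with
  | zero =>
    rw [K.exactAt_iff' 0 0 1 (by simp) (by simp), ShortComplex.moduleCat_exact_iff] at hex
    obtain ⟨x, hx⟩ := hex φ hφ
    have hx0 : (0 : K.X 0) = φ := by
      rw [← hx]
      change 0 = K.d 0 0 x
      rw [K.shape 0 0 (by simp)]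
      rfl
    subst hx0
    exact P.extMk_zero _ rfl
  | succ n =>
    rw [K.exactAt_iff' n (n + 1) (n + 2) (by simp) (by simp),
      ShortComplex.moduleCat_exact_iff] at hex
    obtain ⟨x, hx⟩ := hex φ hφ
    exact (P.extMk_eq_zero_iff _ _ rfl _ n rfl).2 ⟨x, hx⟩

/-- If `i` is smaller than the depth of `N`, then `Ext^i` of the residue field in `N` vanishes. -/
lemma subsingleton_abelianExt_of_lt_rdepth {A : Type} [CommRing A] [IsLocalRing A] {n : ℕ}
    {N : Type} [AddCommGroup N] [Module A N] (h : (n : ℕ∞) < rdepth A N) :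
    Subsingleton (Abelian.Ext (ModuleCat.of A (IsLocalRing.ResidueField A))
      (ModuleCat.of A N) n) := by
  refine subsingleton_abelianExt_of_ext1 ?_
  by_contra hn
  exact h.not_ge (sInf_le ⟨n, rfl, hn⟩)

/-- If `Ext^0` vanishes, then there are no nonzero homomorphisms. -/
lemma subsingleton_linearMap_of_abelianExt {A : Type} [CommRing A] {M N : Type}
    [AddCommGroup M] [Module A M] [AddCommGroup N] [Module A N]
    (h : Subsingleton (Abelian.Ext (ModuleCat.of A M) (ModuleCat.of A N) 0)) :
    Subsingleton (M →ₗ[A] N) :=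
  (Abelian.Ext.homEquiv₀.trans
    (ModuleCat.homEquiv (M := ModuleCat.of A M) (N := ModuleCat.of A N))).symm.subsingleton

lemma nontrivial_linearMap_of_mem_associatedPrimes {A : Type} [CommRing A] [IsNoetherianRing A]
    {N : Type} [AddCommGroup N] [Module A N] {p : Ideal A} (hp : p ∈ associatedPrimes A N) :
    Nontrivial ((A ⧸ p) →ₗ[A] N) := by
  obtain ⟨hprime, x, hx⟩ := isAssociatedPrime_iff.mp hp
  have hker : p = (LinearMap.toSpanSingleton A N x).ker :=
    hx.trans (by simp [SetLike.ext_iff])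
  refine ⟨p.liftQ (LinearMap.toSpanSingleton A N x) hker.le, 0, fun h ↦ ?_⟩
  refine hprime.ne_top ((Ideal.eq_top_iff_one p).2 ?_)
  rw [hker]
  have h1 : LinearMap.toSpanSingleton A N x 1 = 0 := LinearMap.congr_fun h (Ideal.Quotient.mk p 1)
  exact h1

/-- `Ext^n(N, M)` vanishes if `Ext^n(A/q, M)` does for all primes `q` in the support of `N`. -/
lemma subsingleton_ext_of_forall_prime {A : Type} [CommRing A] [IsNoetherianRing A]
    (M : ModuleCat.{0} A) (n : ℕ) {N : Type} [AddCommGroup N] [Module A N] [hN : Module.Finite A N]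
    (h : ∀ q : PrimeSpectrum A, Module.annihilator A N ≤ q.asIdeal →
      Subsingleton (Abelian.Ext (ModuleCat.of A (A ⧸ q.asIdeal)) M n)) :
    Subsingleton (Abelian.Ext (ModuleCat.of A N) M n) := by
  induction hN using IsNoetherianRing.induction_on_isQuotientEquivQuotientPrime A with
  | subsingleton N =>
    have := (ModuleCat.isZero_of_subsingleton (ModuleCat.of A N))
    refine subsingleton_of_forall_eq 0 fun x ↦ ?_
    rw [← Abelian.Ext.mk₀_id_comp x, this.eq_of_src (𝟙 _) 0, Abelian.Ext.mk₀_zero,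
      Abelian.Ext.zero_comp]
  | quotient N p e =>
    have := h p (by rw [e.annihilator_eq, Ideal.annihilator_quotient])
    refine subsingleton_of_forall_eq 0 fun x ↦ ?_
    rw [← Abelian.Ext.mk₀_id_comp x, ← e.toModuleIso.hom_inv_id,
      ← Abelian.Ext.mk₀_comp_mk₀_assoc, Subsingleton.elim (Abelian.Ext.comp _ x _) 0,
      Abelian.Ext.comp_zero]
  | exact N₁ N₂ N₃ f g hf hg hfg h₁ h₃ =>
    have h₁ := h₁ fun q hq ↦ h q ((f.annihilator_le_of_injective hf).trans hq)
    have h₃ := h₃ fun q hq ↦ h q ((g.annihilator_le_of_surjective hg).trans hq)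
    have hS : (ModuleCat.shortComplexOfCompEqZero f g hfg.linearMap_comp_eq_zero).ShortExact :=
      { exact := ModuleCat.shortComplex_exact _ hfg
        mono_f := (ModuleCat.mono_iff_injective _).2 hf
        epi_g := (ModuleCat.epi_iff_surjective _).2 hg }
    refine subsingleton_of_forall_eq 0 fun x ↦ ?_
    obtain ⟨y, rfl⟩ := Abelian.Ext.contravariant_sequence_exact₂ hS M x (h₁.elim _ _)
    rw [h₃.elim y 0, Abelian.Ext.comp_zero]

open scoped Pointwise in
/-- If `Ext^n(A/q, M) ≠ 0` and `q` is not the maximal ideal, then `Ext^(n+1)(A/q', M) ≠ 0` for some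
prime `q'` strictly larger than `q`. -/
lemma exists_lt_nontrivial_ext_succ {A : Type} [CommRing A] [IsNoetherianRing A] [IsLocalRing A]
    (M : ModuleCat.{0} A) [Module.Finite A M] (n : ℕ) (q : PrimeSpectrum A)
    (hq : q.asIdeal ≠ IsLocalRing.maximalIdeal A)
    (h : Nontrivial (Abelian.Ext (ModuleCat.of A (A ⧸ q.asIdeal)) M n)) :
    ∃ q' : PrimeSpectrum A, q < q' ∧
      Nontrivial (Abelian.Ext (ModuleCat.of A (A ⧸ q'.asIdeal)) M (n + 1)) := by
  obtain ⟨x, hxm, hxq⟩ := SetLike.exists_of_lt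
    (lt_of_le_of_ne (IsLocalRing.le_maximalIdeal q.2.ne_top) hq)
  have hreg : IsSMulRegular (A ⧸ q.asIdeal) x := by
    rw [isSMulRegular_iff_right_eq_zero_of_smul]
    intro y hy
    obtain ⟨y, rfl⟩ := Ideal.Quotient.mk_surjective y
    rw [Algebra.smul_def, Ideal.Quotient.algebraMap_eq, ← map_mul,
      Ideal.Quotient.eq_zero_iff_mem] at hy
    exact Ideal.Quotient.eq_zero_iff_mem.2 ((q.2.mem_or_mem hy).resolve_left hxq)
  by_contra! hcon
  have hS := IsSMulRegular.smulShortComplex_shortExact (M := ModuleCat.of A (A ⧸ q.asIdeal)) hreg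
  have h3 : Subsingleton (Abelian.Ext
      ((ModuleCat.of A (A ⧸ q.asIdeal)).smulShortComplex x).X₃ M (n + 1)) := by
    refine subsingleton_ext_of_forall_prime M (n + 1)
      (N := (A ⧸ q.asIdeal) ⧸ (x • (⊤ : Submodule A (A ⧸ q.asIdeal)))) fun q' hq' ↦ ?_
    refine hcon q' (lt_of_le_of_ne ?_ ?_)
    · change q.asIdeal ≤ q'.asIdeal
      refine le_trans ?_ hq'
      refine le_trans ?_ ((Submodule.mkQ _).annihilator_le_of_surjective
        (Submodule.mkQ_surjective _))
      rw [Ideal.annihilator_quotient]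
    · rintro rfl
      refine hxq (hq' (Module.mem_annihilator.2 fun y ↦ ?_))
      obtain ⟨y, rfl⟩ := Submodule.mkQ_surjective _ y
      rw [← map_smul, Submodule.mkQ_apply, Submodule.Quotient.mk_eq_zero]
      exact Submodule.smul_mem_pointwise_smul _ _ _ trivial
  have hsurj (y : Abelian.Ext (ModuleCat.of A (A ⧸ q.asIdeal)) M n) : ∃ z, x • z = y := by
    obtain ⟨z, hz⟩ := Abelian.Ext.contravariant_sequence_exact₁ hS M y (add_comm 1 n)
      (h3.elim _ _)
    have hsmul (w : Abelian.Ext (ModuleCat.of A (A ⧸ q.asIdeal)) M n) :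
        (Abelian.Ext.mk₀ (x • 𝟙 (ModuleCat.of A (A ⧸ q.asIdeal)))).comp w (zero_add n) = x • w := by
      rw [Abelian.Ext.mk₀_smul, Abelian.Ext.smul_comp, Abelian.Ext.mk₀_id_comp]
    exact ⟨z, (hsmul z).symm.trans hz⟩
  have hfin : Module.Finite A (Abelian.Ext (ModuleCat.of A (A ⧸ q.asIdeal)) M n) :=
    inferInstance
  have htop := Submodule.eq_bot_of_le_smul_of_le_jacobson_bot (Ideal.span {x})
    (⊤ : Submodule A (Abelian.Ext (ModuleCat.of A (A ⧸ q.asIdeal)) M n)) hfin.fg_top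
    (fun y _ ↦ by
      obtain ⟨z, rfl⟩ := hsurj y
      exact Submodule.smul_mem_smul (Ideal.mem_span_singleton_self x) trivial)
    (by
      rw [IsLocalRing.jacobson_eq_maximalIdeal ⊥ bot_ne_top]
      simpa [Ideal.span_le] using hxm)
  exact bot_ne_top htop.symm

/-- If `Ext^n(A/q, M) ≠ 0`, then `depth M ≤ dim A/q + n`. -/
lemma rdepth_le_coheight_add {A : Type} [CommRing A] [IsNoetherianRing A] [IsLocalRing A]
    (M : Type) [AddCommGroup M] [Module A M] [Module.Finite A M] (q : PrimeSpectrum A) (n : ℕ)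
    (h : Nontrivial (Abelian.Ext (ModuleCat.of A (A ⧸ q.asIdeal)) (ModuleCat.of A M) n)) :
    rdepth A M ≤ Order.coheight q + n := by
  have : WellFoundedGT (PrimeSpectrum A) :=
    StrictMono.wellFoundedGT (f := PrimeSpectrum.asIdeal) fun _ _ h ↦ h
  induction q using WellFoundedGT.induction generalizing n with
  | _ q ih =>
    by_cases hq : q.asIdeal = IsLocalRing.maximalIdeal A
    · by_contra! hlt
      have := subsingleton_abelianExt_of_lt_rdepth (lt_of_le_of_lt le_add_self hlt)
      rw [hq] at h
      exact not_nontrivial_iff_subsingleton.2 this h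
    · obtain ⟨q', hlt, h'⟩ := exists_lt_nontrivial_ext_succ _ n q hq h
      calc rdepth A M ≤ Order.coheight q' + (n + 1 : ℕ) := ih q' hlt (n + 1) h'
        _ = Order.coheight q' + 1 + n := by push_cast; ring
        _ ≤ _ := by gcongr; exact Order.coheight_add_one_le hlt

/-- If `R` is Cohen-Macaulay, `N` satisfies `(S_1)` and `L` has positive codimension, then every
homomorphism from `L` to `N` vanishes. -/
lemma linearMap_eq_zero_of_codGT_of_serreS {R : Type} [CommRing R] [IsNoetherianRing R]
    [IsLocalRing R] {d : ℕ} (hCM : (d : ℕ∞) ≤ rdepth R R) {L N : Type} [AddCommGroup L]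
    [Module R L] [AddCommGroup N] [Module R N] [Module.Finite R N]
    (hL : codGT R d L 0) (hN : SerreS R 1 N) (φ : L →ₗ[R] N) : φ = 0 := by
  by_contra hφ
  have : Nontrivial (LinearMap.range φ) :=
    Submodule.nontrivial_iff_ne_bot.2 (mt LinearMap.range_eq_bot.1 hφ)
  obtain ⟨p, hp⟩ := associatedPrimes.nonempty R (LinearMap.range φ)
  have hpN := associatedPrimes.subset_of_injective (LinearMap.range φ).injective_subtype hp
  have hann : Module.annihilator R L ≤ p :=
    (φ.rangeRestrict.annihilator_le_of_surjective φ.surjective_rangeRestrict).trans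
      (Submodule.annihilator_top.symm.le.trans hp.annihilator_le)
  have hprime : p.IsPrime := hp.isPrime
  let q : PrimeSpectrum R := ⟨p, hprime⟩
  have hht : ringKrullDim (Localization.AtPrime p) < 1 := by
    by_contra! hge
    have hdep : ((0 : ℕ) : ℕ∞) < rdepth (Localization.AtPrime p)
        (LocalizedModule p.primeCompl N) := by
      have := hN q
      rw [min_eq_left (by simpa using hge)] at this
      exact lt_of_lt_of_le (by simp) (WithBot.coe_le_coe.1 this)
    have h0 := subsingleton_linearMap_of_abelianExt (subsingleton_abelianExt_of_lt_rdepth hdep)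
    have h1 := nontrivial_linearMap_of_mem_associatedPrimes
      (Module.associatedPrimes.mem_associatedPrimes_atPrime_of_mem_associatedPrimes hpN)
    exact not_nontrivial_iff_subsingleton.2 h0 h1
  have hmin : p ∈ minimalPrimes R := by
    rw [IsLocalization.AtPrime.ringKrullDim_eq_height p] at hht
    exact Ideal.height_eq_zero_iff.1 (Order.lt_one_iff.1 (by exact_mod_cast hht))
  have hpR : p ∈ associatedPrimes R R := by
    refine Module.associatedPrimes.minimalPrimes_annihilator_subset_associatedPrimes R R ?_
    rwa [Module.annihilator_eq_bot.2 inferInstance]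
  have hcoh : rdepth R R ≤ Order.coheight q := by
    have h1 := nontrivial_linearMap_of_mem_associatedPrimes hpR
    have := rdepth_le_coheight_add R q 0 (by
      by_contra hc
      have := subsingleton_linearMap_of_abelianExt (not_nontrivial_iff_subsingleton.1 hc)
      exact not_nontrivial_iff_subsingleton.2 this h1)
    simpa using this
  have hle : (Order.coheight q : WithBot ℕ∞) ≤ mdim R L := by
    rw [mdim, ringKrullDim_quotient, Order.coheight_eq_krullDim_Ici]
    exact Order.krullDim_le_of_strictMono
      (fun r : Set.Ici q ↦ (⟨r.1, hann.trans r.2⟩ :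
        PrimeSpectrum.zeroLocus (Module.annihilator R L : Set R))) fun _ _ h ↦ h
  have hlt : mdim R L < d := by simpa [codGT] using hL
  exact absurd (hlt.trans_le (WithBot.coe_le_coe.2 (hCM.trans hcoh))) hle.not_gt

/-- two exact sequences `0 → L → C → N → 0` and `0 → L' → C → N' → 0` with
`cod L, cod L' > 0` and `N, N'` satisfying `(S_1)` are isomorphic as complexes. -/
theorem exact_seq_unique (R : Type) [CommRing R] [IsNoetherianRing R] [IsLocalRing R]
    (d : ℕ) (hdim : ringKrullDim R = d) (hCM : (d : ℕ∞) ≤ rdepth R R)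
    (ω : Type) [AddCommGroup ω] [Module R ω] (hω : IsCanonicalModule R d ω)
    (C L N L' N' : Type) [AddCommGroup C] [Module R C] [AddCommGroup L] [Module R L]
    [AddCommGroup N] [Module R N] [AddCommGroup L'] [Module R L']
    [AddCommGroup N'] [Module R N']
    [Module.Finite R C] [Module.Finite R L] [Module.Finite R N]
    [Module.Finite R L'] [Module.Finite R N']
    (f : L →ₗ[R] C) (g : C →ₗ[R] N) (f' : L' →ₗ[R] C) (g' : C →ₗ[R] N')
    (hf : Function.Injective f) (hfg : Function.Exact f g) (hg : Function.Surjective g)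
    (hf' : Function.Injective f') (hfg' : Function.Exact f' g') (hg' : Function.Surjective g')
    (hL : codGT R d L 0) (hL' : codGT R d L' 0)
    (hN : SerreS R 1 N) (hN' : SerreS R 1 N') :
    ∃ (s : L' ≃ₗ[R] L) (t : N' ≃ₗ[R] N),
      f ∘ₗ (s : L' →ₗ[R] L) = f' ∧ (t : N' →ₗ[R] N) ∘ₗ g' = g := by
  have hle {L₁ L₂ N₂ : Type} [AddCommGroup L₁] [Module R L₁] [AddCommGroup N₂] [Module R N₂]
      [AddCommGroup L₂] [Module R L₂] [Module.Finite R N₂]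
      (f₁ : L₁ →ₗ[R] C) (f₂ : L₂ →ₗ[R] C) (g₂ : C →ₗ[R] N₂) (h₂ : Function.Exact f₂ g₂)
      (hL₁ : codGT R d L₁ 0) (hN₂ : SerreS R 1 N₂) :
      LinearMap.range f₁ ≤ LinearMap.range f₂ := by
    rw [← h₂.linearMap_ker_eq, LinearMap.range_le_ker_iff]
    exact linearMap_eq_zero_of_codGT_of_serreS hCM hL₁ hN₂ _
  have hrange : LinearMap.range f' = LinearMap.range f :=
    le_antisymm (hle f' f g hfg hL' hN) (hle f f' g' hfg' hL hN')
  have hker : LinearMap.ker g' = LinearMap.ker g := by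
    rw [hfg.linearMap_ker_eq, hfg'.linearMap_ker_eq, hrange]
  refine ⟨(LinearEquiv.ofInjective f' hf').trans
      ((LinearEquiv.ofEq _ _ hrange).trans (LinearEquiv.ofInjective f hf).symm),
    (g'.quotKerEquivOfSurjective hg').symm.trans
      ((Submodule.quotEquivOfEq _ _ hker).trans (g.quotKerEquivOfSurjective hg)), ?_, ?_⟩
  · ext x
    exact congrArg Subtype.val ((LinearEquiv.ofInjective f hf).apply_symm_apply
      (LinearEquiv.ofEq _ _ hrange (LinearEquiv.ofInjective f' hf' x)))
  · ext x
    have : (g'.quotKerEquivOfSurjective hg').symm (g' x) = Submodule.Quotient.mk x := by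
      rw [LinearEquiv.symm_apply_eq]
      rfl
    simp [this]
end
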